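/- Under assumptions (a), (b) and the bounded gradient assumption, consider the SSMG iterates with momentum weight β := (ν/T^{2/3})^{1/n} for some ν ≥ 0 such that β ≤ ((R−1)/R)^{1/n} for some R ≥ 1, and diminishing learning rate η_t := γ/(t+λ)^{1/3} for some γ > 0 and λ ≥ 0 with η_1 = γ/(1+λ)^{1/3} ≤ 1/L. Then for every T ≥ 2, (1/Σ_{t=1}^T η_t) · Σ_{t=1}^T η_t·‖∇F(w̃_{t−1})‖² ≤ D_1/[(T+λ)^{2/3} − (1+λ)^{2/3}] + L²·G²·γ²·log(T−1+λ)/[(T+λ)^{2/3} − (1+λ)^{2/3}] + 4·ν·G²·R/T^{2/3}, where D_1 := (2R/γ)·(F(w̃_0) − F_*) + ( R/(γ·L) + R/(1+λ)^{1/3} )·‖∇F(w̃_0)‖² + 2·R·L·γ·G²/(1+λ)^{2/3} + (2/(1+λ))·L²·G²·γ². -/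

import Mathlib

open Finset

section Smooth

variable {E : Type*} [NormedAddCommGroup E] [InnerProductSpace ℝ E] [CompleteSpace E]

/-- The descent lemma: quadratic upper bound for a function with Lipschitz gradient. -/
theorem le_quadratic_of_lipschitz_gradient {F : E → ℝ} {L : ℝ} (hF : Differentiable ℝ F)
    (hL : ∀ x y, ‖gradient F x - gradient F y‖ ≤ L * ‖x - y‖) (x v : E) :
    F (x + v) ≤ F x + inner ℝ (gradient F x) v + L / 2 * ‖v‖ ^ 2 := by
  set φ : ℝ → ℝ := fun s => F (x + s • v) - s * inner ℝ (gradient F x) v - L / 2 * s ^ 2 * ‖v‖ ^ 2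
    with hφ
  have hderiv : ∀ s, HasDerivAt φ
      (inner ℝ (gradient F (x + s • v)) v - inner ℝ (gradient F x) v - L * s * ‖v‖ ^ 2) s := by
    intro s
    have h1 : HasDerivAt (fun s : ℝ => x + s • v) v s := by
      simpa using ((hasDerivAt_id s).smul_const v).const_add x
    have h2 : HasDerivAt (fun s : ℝ => F (x + s • v)) (inner ℝ (gradient F (x + s • v)) v) s := by
      exact (hF (x + s • v)).hasGradientAt.hasFDerivAt.comp_hasDerivAt s h1
    have h4 := (h2.sub ((hasDerivAt_id s).mul_const (inner ℝ (gradient F x) v))).sub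
      ((((hasDerivAt_id s).pow 2).const_mul (L / 2)).mul_const (‖v‖ ^ 2))
    refine (h4.congr_deriv ?_)
    simp only [id_eq, Nat.cast_ofNat]
    ring
  have hanti : AntitoneOn φ (Set.Icc 0 1) := by
    refine antitoneOn_of_deriv_nonpos (convex_Icc 0 1)
      (fun s _ => (hderiv s).continuousAt.continuousWithinAt)
      (fun s _ => (hderiv s).differentiableAt.differentiableWithinAt) ?_
    intro s hs
    rw [interior_Icc] at hs
    rw [(hderiv s).deriv, ← inner_sub_left]
    have h5 : inner ℝ (gradient F (x + s • v) - gradient F x) v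
        ≤ ‖gradient F (x + s • v) - gradient F x‖ * ‖v‖ := real_inner_le_norm _ _
    have h6 := hL (x + s • v) x
    rw [add_sub_cancel_left, norm_smul, Real.norm_of_nonneg hs.1.le] at h6
    nlinarith [mul_le_mul_of_nonneg_right h6 (norm_nonneg v)]
  have h := hanti (Set.left_mem_Icc.2 zero_le_one) (Set.right_mem_Icc.2 zero_le_one) zero_le_one
  simp only [hφ, zero_smul, one_smul, add_zero] at h
  linarith

/-- One inexact gradient step with step size at most `1 / L`. -/
theorem inexact_gradient_step {F : E → ℝ} {L η : ℝ} (hF : Differentiable ℝ F)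
    (hL : ∀ x y, ‖gradient F x - gradient F y‖ ≤ L * ‖x - y‖) (hη : 0 ≤ η) (hηL : L * η ≤ 1)
    (x p : E) :
    F (x - η • p) ≤ F x - η / 2 * ‖gradient F x‖ ^ 2 + η / 2 * ‖gradient F x - p‖ ^ 2 := by
  have h := le_quadratic_of_lipschitz_gradient hF hL x (-(η • p))
  rw [← sub_eq_add_neg, inner_neg_right, inner_smul_right, norm_neg, norm_smul,
    Real.norm_of_nonneg hη] at h
  rw [norm_sub_sq_real]
  nlinarith [mul_nonneg (mul_nonneg hη (sub_nonneg.2 hηL)) (sq_nonneg ‖p‖)]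

/-- A crude bound for a step in an arbitrary direction. -/
theorem arbitrary_step {F : E → ℝ} {L η : ℝ} (hF : Differentiable ℝ F) (hL0 : 0 < L)
    (hL : ∀ x y, ‖gradient F x - gradient F y‖ ≤ L * ‖x - y‖) (hη : 0 ≤ η) (x p : E) :
    F (x - η • p) ≤ F x + 1 / (2 * L) * ‖gradient F x‖ ^ 2 + L * η ^ 2 * ‖p‖ ^ 2 := by
  have h := le_quadratic_of_lipschitz_gradient hF hL x (-(η • p))
  have h1 := real_inner_le_norm (gradient F x) (-(η • p))
  rw [norm_neg, norm_smul, Real.norm_of_nonneg hη] at h h1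
  rw [← sub_eq_add_neg] at h
  have h2 : 1 / (2 * L) * ‖gradient F x‖ ^ 2 + L / 2 * (η * ‖p‖) ^ 2
      - ‖gradient F x‖ * (η * ‖p‖)
      = 1 / (2 * L) * (‖gradient F x‖ - L * (η * ‖p‖)) ^ 2 := by
    field_simp
    ring
  have h3 : 0 ≤ 1 / (2 * L) * (‖gradient F x‖ - L * (η * ‖p‖)) ^ 2 := by positivity
  nlinarith

theorem hasGradientAt_average {n : ℕ} {f : Fin n → E → ℝ} (hf : ∀ i, Differentiable ℝ (f i))
    (x : E) :
    HasGradientAt (fun x => (1 / (n : ℝ)) * ∑ i, f i x)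
      ((1 / (n : ℝ)) • ∑ i, gradient (f i) x) x := by
  rw [hasGradientAt_iff_hasFDerivAt, map_smul, map_sum]
  exact (HasFDerivAt.fun_sum fun i _ => (hf i x).hasGradientAt.hasFDerivAt).const_mul _

end Smooth

section Momentum

variable {E : Type*} [NormedAddCommGroup E] [NormedSpace ℝ E]

theorem norm_average_le {n : ℕ} (hn : 1 ≤ n) {v : Fin n → E} {C : ℝ} (hv : ∀ i, ‖v i‖ ≤ C) :
    ‖(1 / (n : ℝ)) • ∑ i, v i‖ ≤ C := by
  have hn' : (0 : ℝ) < n := by exact_mod_cast hn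
  have h : ‖∑ i, v i‖ ≤ n * C := by
    simpa using norm_sum_le_of_le univ fun i _ => hv i
  rw [norm_smul, Real.norm_of_nonneg (by positivity), one_div, inv_mul_le_iff₀ hn']
  exact h

theorem sum_range_shift_of_periodic {M : Type*} [AddCommGroup M] {n : ℕ} {h : ℕ → M}
    (hper : ∀ k, h (k + n) = h k) (l : ℕ) :
    ∑ i ∈ range n, h (i + l) = ∑ i ∈ range n, h i := by
  induction l with
  | zero => simp
  | succ l ih =>
    rw [← ih]
    have h1 := sum_range_succ (fun i => h (i + l)) n
    rw [sum_range_succ', zero_add, add_comm n l, hper] at h1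
    refine Eq.trans (sum_congr rfl fun i _ => ?_) (add_right_cancel h1)
    congr 1
    ring

/-- Unrolling `k` steps of an exponential moving average. -/
theorem moving_average_unroll {β : ℝ} {u x : ℕ → E} {a : ℕ} (k : ℕ)
    (hu : ∀ j < k, u (a + j + 1) = β • u (a + j) + (1 - β) • x (a + j)) :
    u (a + k) = β ^ k • u a + (1 - β) • ∑ l ∈ range k, β ^ (k - 1 - l) • x (a + l) := by
  induction k with
  | zero => simp
  | succ k ih =>
    rw [← add_assoc, hu k (Nat.lt_succ_self k), ih fun j hj => hu j (hj.trans (Nat.lt_succ_self k)),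
      sum_range_succ]
    have h1 : ∑ l ∈ range k, β ^ (k + 1 - 1 - l) • x (a + l)
        = β • ∑ l ∈ range k, β ^ (k - 1 - l) • x (a + l) := by
      rw [smul_sum]
      refine sum_congr rfl fun l hl => ?_
      have := mem_range.1 hl
      rw [smul_smul, ← pow_succ']
      congr 2
      omega
    rw [h1]
    simp only [add_tsub_cancel_right, tsub_self, pow_zero, one_smul]
    module

theorem one_sub_mul_sum_pow (β : ℝ) (n : ℕ) :
    (1 - β) * ∑ l ∈ range n, β ^ (n - 1 - l) = 1 - β ^ n := by
  rw [sum_range_reflect (fun l => β ^ l) n]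
  exact mul_neg_geom_sum β n

/-- Over two consecutive epochs, the total momentum of the second epoch is a convex combination
of the total momentum of the first one and a weighted sum of the gradients, which is close to a
reference sum `∑ h i` when all the gradients are close to the reference gradients. -/
theorem norm_sum_momentum_sub_le {n : ℕ} {β X : ℝ} (hβ0 : 0 ≤ β) (hβ1 : β ≤ 1)
    {m m' g g' h : ℕ → E}
    (hm : ∀ i < n, m (i + 1) = β • m i + (1 - β) • g i)
    (hm' : ∀ i < n, m' (i + 1) = β • m' i + (1 - β) • g' i)
    (hmm' : m' 0 = m n)
    (hg : ∀ i < n, ‖g i - h i‖ ≤ X) (hg' : ∀ i < n, ‖g' i - h i‖ ≤ X) :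
    ‖∑ i ∈ range n, m' (i + 1) - β ^ n • ∑ i ∈ range n, m (i + 1)
        - (1 - β ^ n) • ∑ i ∈ range n, h i‖ ≤ n * ((1 - β ^ n) * X) := by
  rcases Nat.eq_zero_or_pos n with rfl | hn
  · simp
  set u : ℕ → E := fun k => if k ≤ n then m k else m' (k - n) with hu
  set x : ℕ → E := fun k => if k < n then g k else g' (k - n) with hx
  set H : ℕ → E := fun k => h (k % n) with hH
  have hurec : ∀ k < 2 * n, u (k + 1) = β • u k + (1 - β) • x k := by
    intro k hk
    simp only [hu, hx]
    rcases lt_trichotomy k n with h1 | h1 | h1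
    · rw [if_pos (by omega), if_pos h1.le, if_pos h1, hm k h1]
    · subst h1
      rw [if_neg (by omega), if_pos le_rfl, if_neg (by omega), ← hmm', Nat.sub_self,
        show k + 1 - k = 0 + 1 by omega, hm' 0 hn]
    · rw [if_neg (by omega), if_neg (by omega), if_neg (by omega), ← hm' (k - n) (by omega)]
      congr 1
      omega
  have hxH : ∀ k < 2 * n, ‖x k - H k‖ ≤ X := by
    intro k hk
    simp only [hx, hH]
    split_ifs with h1
    · rw [Nat.mod_eq_of_lt h1]
      exact hg k h1
    · rw [Nat.mod_eq_sub_mod (by omega), Nat.mod_eq_of_lt (by omega)]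
      exact hg' _ (by omega)
  have hdiff : ∀ i < n, m' (i + 1) - β ^ n • m (i + 1)
      = (1 - β) • ∑ l ∈ range n, β ^ (n - 1 - l) • x (i + 1 + l) := by
    intro i hi
    have h1 := moving_average_unroll (a := i + 1) (u := u) (x := x) (β := β) n
      (fun j hj => hurec _ (by omega))
    have h2 : u (i + 1 + n) = m' (i + 1) := by
      simp only [hu]
      rw [if_neg (by omega), Nat.add_sub_cancel]
    have h3 : u (i + 1) = m (i + 1) := by
      simp only [hu]
      rw [if_pos (by omega)]
    rw [h2, h3] at h1
    rw [h1, add_sub_cancel_left]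
  have href : ∑ i ∈ range n, (1 - β) • ∑ l ∈ range n, β ^ (n - 1 - l) • H (i + 1 + l)
      = (1 - β ^ n) • ∑ i ∈ range n, h i := by
    rw [← smul_sum, sum_comm]
    have h1 : ∀ l ∈ range n, ∑ i ∈ range n, β ^ (n - 1 - l) • H (i + 1 + l)
        = β ^ (n - 1 - l) • ∑ i ∈ range n, h i := by
      intro l _
      rw [← smul_sum]
      congr 1
      simp only [add_assoc]
      rw [sum_range_shift_of_periodic (h := H) (fun k => by simp [hH]) (1 + l)]
      exact sum_congr rfl fun i hi => by simp only [hH]; rw [Nat.mod_eq_of_lt (mem_range.1 hi)]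
    rw [sum_congr rfl h1, ← sum_smul, smul_smul, one_sub_mul_sum_pow]
  rw [← href, smul_sum, ← sum_sub_distrib, ← sum_sub_distrib]
  have hterm : ∀ i ∈ range n, ‖m' (i + 1) - β ^ n • m (i + 1)
      - (1 - β) • ∑ l ∈ range n, β ^ (n - 1 - l) • H (i + 1 + l)‖ ≤ (1 - β ^ n) * X := by
    intro i hi
    have hi := mem_range.1 hi
    rw [hdiff i hi, ← smul_sub, ← sum_sub_distrib, norm_smul,
      Real.norm_of_nonneg (sub_nonneg.2 hβ1), ← one_sub_mul_sum_pow, mul_assoc, sum_mul]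
    refine mul_le_mul_of_nonneg_left (norm_sum_le_of_le _ fun l hl => ?_) (sub_nonneg.2 hβ1)
    have hl := mem_range.1 hl
    rw [← smul_sub, norm_smul, Real.norm_of_nonneg (by positivity)]
    exact mul_le_mul_of_nonneg_left (hxH _ (by omega)) (by positivity)
  simpa using norm_sum_le_of_le _ hterm

theorem norm_moving_average_le {n : ℕ} {β G : ℝ} (hβ0 : 0 ≤ β) (hβ1 : β ≤ 1) {m g : ℕ → E}
    (hm : ∀ i < n, m (i + 1) = β • m i + (1 - β) • g i) (hm0 : ‖m 0‖ ≤ G)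
    (hg : ∀ i < n, ‖g i‖ ≤ G) : ∀ i ≤ n, ‖m i‖ ≤ G := by
  intro i
  induction i with
  | zero => exact fun _ => hm0
  | succ i ih =>
    intro hi
    rw [hm i hi]
    refine (norm_add_le _ _).trans ?_
    rw [norm_smul, norm_smul, Real.norm_of_nonneg hβ0, Real.norm_of_nonneg (sub_nonneg.2 hβ1)]
    nlinarith [ih (by omega), hg i hi]

theorem eq_sub_smul_sum {n : ℕ} {c : ℝ} {w m : ℕ → E}
    (hw : ∀ i < n, w (i + 1) = w i - c • m (i + 1)) (a k : ℕ) (hk : a + k ≤ n) :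
    w (a + k) = w a - c • ∑ i ∈ range k, m (a + i + 1) := by
  induction k with
  | zero => simp
  | succ k ih =>
    rw [← add_assoc, hw _ (by omega), ih (by omega), sum_range_succ]
    module

/-- The iterates of one epoch stay within distance `η * G` of each other. -/
theorem norm_iterate_sub_le {n : ℕ} {η G : ℝ} (hη : 0 ≤ η) {w m : ℕ → E}
    (hw : ∀ i < n, w (i + 1) = w i - (η / (n : ℝ)) • m (i + 1))
    (hm : ∀ i ≤ n, ‖m i‖ ≤ G) (a b : ℕ) (hab : a ≤ b) (hb : b ≤ n) :
    ‖w a - w b‖ ≤ η * G := by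
  rcases Nat.eq_zero_or_pos n with rfl | hn
  · obtain rfl : b = 0 := by omega
    obtain rfl : a = 0 := by omega
    have := (norm_nonneg _).trans (hm 0 le_rfl)
    simpa using mul_nonneg hη this
  obtain ⟨k, rfl⟩ := Nat.exists_eq_add_of_le hab
  have hG : 0 ≤ G := (norm_nonneg _).trans (hm 0 n.zero_le)
  have hn' : (0 : ℝ) < n := by exact_mod_cast hn
  rw [eq_sub_smul_sum hw a k hb, sub_sub_cancel, norm_smul, Real.norm_of_nonneg (by positivity)]
  have h1 : ‖∑ i ∈ range k, m (a + i + 1)‖ ≤ k * G := by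
    simpa using norm_sum_le_of_le (range k) fun i hi =>
      hm (a + i + 1) (by have := mem_range.1 hi; omega)
  have h2 : (k : ℝ) ≤ n := by exact_mod_cast (by omega : k ≤ n)
  calc η / n * ‖∑ i ∈ range k, m (a + i + 1)‖ ≤ η / n * (n * G) := by
        refine mul_le_mul_of_nonneg_left (h1.trans ?_) (by positivity)
        exact mul_le_mul_of_nonneg_right h2 hG
    _ = η * G := by field_simp

end Momentum

section Rates

theorem rpow_two_thirds_succ_sub_le {x : ℝ} (hx : 0 < x) :
    (x + 1) ^ ((2 : ℝ) / 3) - x ^ ((2 : ℝ) / 3) ≤ 1 / x ^ ((1 : ℝ) / 3) := by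
  have h1 : x + 1 = x * (1 + 1 / x) := by field_simp
  have h2 : (1 + 1 / x) ^ ((2 : ℝ) / 3) ≤ 1 + 1 / x := by
    have h0 : (1 : ℝ) ≤ 1 + 1 / x := le_add_of_nonneg_right (by positivity)
    simpa using Real.rpow_le_rpow_of_exponent_le h0 (by norm_num : (2 : ℝ) / 3 ≤ 1)
  have h3 : x ^ ((2 : ℝ) / 3) * (1 / x) = 1 / x ^ ((1 : ℝ) / 3) := by
    rw [one_div, one_div, ← Real.rpow_neg hx.le, ← Real.rpow_neg_one x, ← Real.rpow_add hx]
    norm_num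
  rw [h1, Real.mul_rpow hx.le (by positivity), ← h3]
  nlinarith [Real.rpow_nonneg hx.le ((2 : ℝ) / 3)]

theorem rpow_two_thirds_sub_le_sum {lam : ℝ} (hlam : 0 ≤ lam) (N : ℕ) :
    ((N : ℝ) + 1 + lam) ^ ((2 : ℝ) / 3) - (1 + lam) ^ ((2 : ℝ) / 3)
      ≤ ∑ t ∈ range N, 1 / (((t + 1 : ℕ) : ℝ) + lam) ^ ((1 : ℝ) / 3) := by
  induction N with
  | zero => simp
  | succ N ih =>
    rw [sum_range_succ]
    have h := rpow_two_thirds_succ_sub_le (x := ((N + 1 : ℕ) : ℝ) + lam) (by positivity)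
    push_cast at h ih ⊢
    rw [show (N : ℝ) + 1 + 1 + lam = N + 1 + lam + 1 by ring]
    linarith

theorem sum_inv_le_log {lam : ℝ} (hlam : 0 ≤ lam) (N : ℕ) :
    ∑ t ∈ range (N + 1), 1 / (((t + 1 : ℕ) : ℝ) + lam)
      ≤ 1 / (1 + lam) + Real.log ((N : ℝ) + 1 + lam) := by
  induction N with
  | zero => simpa using Real.log_nonneg (by linarith : (1 : ℝ) ≤ 1 + lam)
  | succ N ih =>
    rw [sum_range_succ]
    have hx : 0 < (N : ℝ) + 1 + lam := by positivity
    have hy : 0 < (N : ℝ) + 1 + 1 + lam := by positivity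
    have h := Real.one_sub_inv_le_log_of_pos (div_pos hy hx)
    rw [Real.log_div hy.ne' hx.ne', inv_div] at h
    have h2 : 1 - ((N : ℝ) + 1 + lam) / (N + 1 + 1 + lam) = 1 / (N + 1 + 1 + lam) := by
      field_simp
      ring
    push_cast at ih ⊢
    linarith

end Rates

/-- If the average momentum `p'` of an epoch is, up to an error `(1 - q) * X`, the convex
combination `q • p + (1 - q) • v`, then `p'` approximates `v` in mean square. -/
theorem norm_sub_sq_le_of_combination {E : Type*} [NormedAddCommGroup E] [NormedSpace ℝ E]
    {q X G : ℝ} (hq0 : 0 ≤ q) (hq1 : q ≤ 1) {v p p' : E} (hv : ‖v‖ ≤ G) (hp : ‖p‖ ≤ G)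
    (h : ‖p' - q • p - (1 - q) • v‖ ≤ (1 - q) * X) :
    ‖v - p'‖ ^ 2 ≤ 4 * q * G ^ 2 + X ^ 2 := by
  have h1 : v - p' = q • (v - p) - (p' - q • p - (1 - q) • v) := by module
  have h2 : ‖v - p'‖ ≤ q * (2 * G) + (1 - q) * X := by
    rw [h1]
    refine (norm_sub_le _ _).trans (add_le_add ?_ h)
    rw [norm_smul, Real.norm_of_nonneg hq0]
    exact mul_le_mul_of_nonneg_left ((norm_sub_le _ _).trans (by linarith)) hq0
  have h3 : ‖v - p'‖ ^ 2 ≤ (q * (2 * G) + (1 - q) * X) ^ 2 := by gcongr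
  nlinarith [mul_nonneg (mul_nonneg hq0 (sub_nonneg.2 hq1)) (sq_nonneg (2 * G - X)),
    mul_nonneg hq0 (sq_nonneg X)]

theorem ssmg_diminishing_lr
    (n d : ℕ) (hn : 1 ≤ n) (hd : 1 ≤ d)
    (f : Fin n → EuclideanSpace ℝ (Fin d) → ℝ)
    (hf : ∀ i, Differentiable ℝ (f i))
    (F : EuclideanSpace ℝ (Fin d) → ℝ)
    (hF : F = fun x => (1 / (n : ℝ)) * ∑ i, f i x)
    (L : ℝ) (hL : 0 < L)
    (hsmooth : ∀ i x y, ‖gradient (f i) x - gradient (f i) y‖ ≤ L * ‖x - y‖)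
    (Fstar : ℝ) (hFstar : IsGLB (Set.range F) Fstar)
    (G : ℝ) (hG : 0 < G)
    (hbg : ∀ i x, ‖gradient (f i) x‖ ≤ G)
    (T : ℕ) (hT : 1 ≤ T)
    (β : ℝ) (hβ0 : 0 ≤ β) (hβ1 : β < 1)
    (η : ℕ → ℝ) (hηpos : ∀ t, 1 ≤ t → t ≤ T → 0 < η t)
    (π : Equiv.Perm (Fin n))
    (w m g : ℕ → ℕ → EuclideanSpace ℝ (Fin d))
    (wt mt : ℕ → EuclideanSpace ℝ (Fin d))
    (hmt0 : mt 0 = 0)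
    (hw0 : ∀ t, 1 ≤ t → t ≤ T → w t 0 = wt (t - 1))
    (hm0 : ∀ t, 1 ≤ t → t ≤ T → m t 0 = mt (t - 1))
    (hg : ∀ t, 1 ≤ t → t ≤ T → ∀ i, ∀ hi : i < n,
        g t i = gradient (f (π ⟨i, hi⟩)) (w t i))
    (hm1 : ∀ t, 1 ≤ t → t ≤ T → ∀ i, i < n →
        m t (i + 1) = β • m t i + (1 - β) • g t i)
    (hw1 : ∀ t, 1 ≤ t → t ≤ T → ∀ i, i < n →
        w t (i + 1) = w t i - (η t / (n : ℝ)) • m t (i + 1))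
    (hwt : ∀ t, 1 ≤ t → t ≤ T → wt t = w t n)
    (hmt : ∀ t, 1 ≤ t → t ≤ T → mt t = m t n)
    (ν R γ lam : ℝ) (hν : 0 ≤ ν) (hR : 1 ≤ R) (hγ : 0 < γ) (hlam : 0 ≤ lam)
    (hβdef : β = (ν / (T : ℝ) ^ ((2 : ℝ) / 3)) ^ ((1 : ℝ) / (n : ℝ)))
    (hβR : β ≤ ((R - 1) / R) ^ ((1 : ℝ) / (n : ℝ)))
    (hη : ∀ t, 1 ≤ t → η t = γ / ((t : ℝ) + lam) ^ ((1 : ℝ) / 3))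
    (hη1L : γ / ((1 : ℝ) + lam) ^ ((1 : ℝ) / 3) ≤ 1 / L)
    (hT2 : 2 ≤ T) :
    (∑ t ∈ Icc 1 T, η t * ‖gradient F (wt (t - 1))‖ ^ 2) / (∑ t ∈ Icc 1 T, η t)
      ≤ (2 * R / γ * (F (wt 0) - Fstar)
            + (R / (γ * L) + R / ((1 : ℝ) + lam) ^ ((1 : ℝ) / 3))
              * ‖gradient F (wt 0)‖ ^ 2
            + 2 * R * L * γ * G ^ 2 / ((1 : ℝ) + lam) ^ ((2 : ℝ) / 3)
            + 2 / (1 + lam) * L ^ 2 * G ^ 2 * γ ^ 2)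
          / (((T : ℝ) + lam) ^ ((2 : ℝ) / 3) - ((1 : ℝ) + lam) ^ ((2 : ℝ) / 3))
        + L ^ 2 * G ^ 2 * γ ^ 2 * Real.log ((T : ℝ) - 1 + lam)
          / (((T : ℝ) + lam) ^ ((2 : ℝ) / 3) - ((1 : ℝ) + lam) ^ ((2 : ℝ) / 3))
        + 4 * ν * G ^ 2 * R / (T : ℝ) ^ ((2 : ℝ) / 3) := by
  have hn' : (0 : ℝ) < n := by exact_mod_cast hn
  have hq : β ^ n = ν / (T : ℝ) ^ ((2 : ℝ) / 3) := by
    rw [hβdef, one_div, Real.rpow_inv_natCast_pow (by positivity) (by omega)]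
  have hq0 : 0 ≤ β ^ n := by positivity
  have hq1 : β ^ n ≤ 1 := pow_le_one₀ hβ0 hβ1.le
  have hηp : ∀ t, 1 ≤ t → 0 < η t := fun t ht => by rw [hη t ht]; positivity
  have hηanti : ∀ s t, 1 ≤ s → s ≤ t → η t ≤ η s := by
    intro s t hs hst
    have hst' : (s : ℝ) ≤ t := by exact_mod_cast hst
    rw [hη s hs, hη t (hs.trans hst)]
    gcongr
  have hηL : ∀ t, 1 ≤ t → L * η t ≤ 1 := by
    intro t ht
    have h1 := hηanti 1 t le_rfl ht
    rw [hη 1 le_rfl, Nat.cast_one] at h1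
    rw [mul_comm]
    exact (le_div_iff₀ hL).1 (h1.trans hη1L)
  have hgradF : ∀ x, gradient F x = (1 / (n : ℝ)) • ∑ i, gradient (f i) x := by
    intro x
    rw [hF]
    exact (hasGradientAt_average hf x).gradient
  have hFdiff : Differentiable ℝ F := by
    rw [hF]
    exact fun x => (hasGradientAt_average hf x).differentiableAt
  have hFG : ∀ x, ‖gradient F x‖ ≤ G := by
    intro x
    rw [hgradF]
    exact norm_average_le hn fun i => hbg i x
  have hFL : ∀ x y, ‖gradient F x - gradient F y‖ ≤ L * ‖x - y‖ := by
    intro x y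
    rw [hgradF, hgradF, ← smul_sub, ← sum_sub_distrib]
    exact norm_average_le hn fun i => hsmooth i x y
  have hgG : ∀ t, 1 ≤ t → t ≤ T → ∀ i < n, ‖g t i‖ ≤ G := by
    intro t ht htT i hi
    rw [hg t ht htT i hi]
    exact hbg _ _
  have hmtG : ∀ t, t ≤ T → ‖mt t‖ ≤ G := by
    intro t
    induction t with
    | zero => exact fun _ => by rw [hmt0, norm_zero]; exact hG.le
    | succ t ih =>
      intro ht
      rw [hmt (t + 1) (by omega) ht]
      refine norm_moving_average_le hβ0 hβ1.le (hm1 (t + 1) (by omega) ht) ?_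
        (hgG (t + 1) (by omega) ht) n le_rfl
      rw [hm0 (t + 1) (by omega) ht]
      exact ih (by omega)
  have hmG : ∀ t, 1 ≤ t → t ≤ T → ∀ i ≤ n, ‖m t i‖ ≤ G := by
    intro t ht htT
    refine norm_moving_average_le hβ0 hβ1.le (hm1 t ht htT) ?_ (hgG t ht htT)
    rw [hm0 t ht htT]
    exact hmtG _ (by omega)
  set P : ℕ → EuclideanSpace ℝ (Fin d) := fun t => (1 / (n : ℝ)) • ∑ i ∈ range n, m t (i + 1)
    with hP
  have hPG : ∀ t, 1 ≤ t → t ≤ T → ‖P t‖ ≤ G := by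
    intro t ht htT
    simp only [hP]
    rw [sum_range]
    exact norm_average_le hn fun i => hmG t ht htT _ i.2
  have hepoch : ∀ t, 1 ≤ t → t ≤ T → wt t = wt (t - 1) - η t • P t := by
    intro t ht htT
    have h1 := eq_sub_smul_sum (hw1 t ht htT) 0 n (by omega)
    simp only [zero_add] at h1
    rw [hwt t ht htT, h1, hw0 t ht htT]
    simp only [hP]
    rw [smul_smul, mul_one_div]
  have herr : ∀ t, 1 ≤ t → t + 1 ≤ T →
      ‖gradient F (wt t) - P (t + 1)‖ ^ 2 ≤ 4 * β ^ n * G ^ 2 + (L * (η t * G)) ^ 2 := by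
    intro t ht htT
    have ht0 : t ≤ T := by omega
    set h : ℕ → EuclideanSpace ℝ (Fin d) := fun i =>
      if hi : i < n then gradient (f (π ⟨i, hi⟩)) (wt t) else 0 with hh
    have hsum : ∑ i ∈ range n, h i = (n : ℝ) • gradient F (wt t) := by
      rw [hgradF, smul_smul, mul_one_div_cancel hn'.ne', one_smul, sum_range,
        ← Equiv.sum_comp π fun i => gradient (f i) (wt t)]
      exact sum_congr rfl fun i _ => by simp [hh]
    have hg1 : ∀ i < n, ‖g t i - h i‖ ≤ L * (η t * G) := by
      intro i hi
      simp only [hh]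
      rw [dif_pos hi, hg t ht ht0 i hi, hwt t ht ht0]
      refine (hsmooth _ _ _).trans (mul_le_mul_of_nonneg_left ?_ hL.le)
      exact norm_iterate_sub_le (hηp t ht).le (hw1 t ht ht0) (hmG t ht ht0) i n hi.le le_rfl
    have hg2 : ∀ i < n, ‖g (t + 1) i - h i‖ ≤ L * (η t * G) := by
      intro i hi
      simp only [hh]
      rw [dif_pos hi, hg (t + 1) (by omega) htT i hi]
      refine (hsmooth _ _ _).trans (mul_le_mul_of_nonneg_left ?_ hL.le)
      have h1 := norm_iterate_sub_le (hηp (t + 1) (by omega)).le (hw1 (t + 1) (by omega) htT)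
        (hmG (t + 1) (by omega) htT) 0 i i.zero_le hi.le
      rw [hw0 (t + 1) (by omega) htT, Nat.add_sub_cancel, norm_sub_rev] at h1
      exact h1.trans (mul_le_mul_of_nonneg_right (hηanti t (t + 1) ht (by omega)) hG.le)
    have hmm : m (t + 1) 0 = m t n := by
      rw [hm0 (t + 1) (by omega) htT, Nat.add_sub_cancel, hmt t ht ht0]
    have hkey := norm_sum_momentum_sub_le hβ0 hβ1.le (hm1 t ht ht0)
      (hm1 (t + 1) (by omega) htT) hmm hg1 hg2
    refine norm_sub_sq_le_of_combination hq0 hq1 (hFG _) (hPG t ht ht0) ?_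
    have hscale : P (t + 1) - β ^ n • P t - (1 - β ^ n) • gradient F (wt t)
        = (1 / (n : ℝ)) • (∑ i ∈ range n, m (t + 1) (i + 1)
          - β ^ n • ∑ i ∈ range n, m t (i + 1) - (1 - β ^ n) • ∑ i ∈ range n, h i) := by
      rw [hsum]
      simp only [hP, smul_sub, smul_smul]
      congr 2
      · rw [mul_comm]
      · field_simp
    rw [hscale, norm_smul, Real.norm_of_nonneg (by positivity), one_div, inv_mul_le_iff₀ hn']
    exact hkey
  have hdescent : ∀ t, 1 ≤ t → t + 1 ≤ T → η (t + 1) * ‖gradient F (wt t)‖ ^ 2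
      ≤ 2 * (F (wt t) - F (wt (t + 1))) + 4 * β ^ n * G ^ 2 * η (t + 1)
        + L ^ 2 * G ^ 2 * η t ^ 3 := by
    intro t ht htT
    have h0 := hηp (t + 1) (by omega)
    have h1 := inexact_gradient_step hFdiff hFL h0.le (hηL (t + 1) (by omega)) (wt t) (P (t + 1))
    have h2 := hepoch (t + 1) (by omega) htT
    rw [Nat.add_sub_cancel] at h2
    rw [← h2] at h1
    have h3 := mul_le_mul_of_nonneg_left (herr t ht htT) h0.le
    have h4 := mul_le_mul_of_nonneg_right (hηanti t (t + 1) ht (by omega))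
      (sq_nonneg (L * (η t * G)))
    nlinarith
  have hfirst : 2 * F (wt 1) ≤ 2 * F (wt 0) + 1 / L * ‖gradient F (wt 0)‖ ^ 2
      + 2 * L * G ^ 2 * η 1 ^ 2 := by
    have h1 := arbitrary_step hFdiff hL hFL (hηp 1 le_rfl).le (wt 0) (P 1)
    have h2 := hepoch 1 le_rfl hT
    rw [Nat.sub_self] at h2
    rw [← h2] at h1
    have h3 : ‖P 1‖ ^ 2 ≤ G ^ 2 := pow_le_pow_left₀ (norm_nonneg _) (hPG 1 le_rfl hT) 2
    have h4 := mul_le_mul_of_nonneg_left h3 (by positivity : 0 ≤ L * η 1 ^ 2)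
    have h5 : 1 / (2 * L) = 1 / L / 2 := by field_simp
    rw [h5] at h1
    linarith
  have htel : ∀ N, N + 1 ≤ T → ∑ t ∈ range N, η (t + 2) * ‖gradient F (wt (t + 1))‖ ^ 2
      ≤ 2 * (F (wt 1) - F (wt (N + 1))) + 4 * β ^ n * G ^ 2 * ∑ t ∈ range N, η (t + 2)
        + L ^ 2 * G ^ 2 * ∑ t ∈ range N, η (t + 1) ^ 3 := by
    intro N
    induction N with
    | zero => simp
    | succ N ih =>
      intro hN
      rw [sum_range_succ, sum_range_succ, sum_range_succ]
      linarith [ih (by omega), hdescent (N + 1) (by omega) hN]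
  have hIcc : ∀ a : ℕ → ℝ, ∑ t ∈ Icc 1 T, a t = ∑ t ∈ range T, a (t + 1) := by
    intro a
    rw [range_eq_Ico, sum_Ico_add' a 0 T 1]
    rfl
  obtain ⟨N, rfl⟩ : ∃ N, T = N + 2 := ⟨T - 2, by omega⟩
  have hS : γ * ((((N + 2 : ℕ) : ℝ) + lam) ^ ((2 : ℝ) / 3) - (1 + lam) ^ ((2 : ℝ) / 3))
      ≤ ∑ t ∈ Icc 1 (N + 2), η t := by
    have h1 := mul_le_mul_of_nonneg_left (rpow_two_thirds_sub_le_sum hlam (N + 1)) hγ.le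
    rw [hIcc, sum_range_succ]
    have h2 : ∑ t ∈ range (N + 1), η (t + 1)
        = γ * ∑ t ∈ range (N + 1), 1 / (((t + 1 : ℕ) : ℝ) + lam) ^ ((1 : ℝ) / 3) := by
      rw [mul_sum]
      exact sum_congr rfl fun t _ => by rw [hη (t + 1) (by omega), mul_one_div]
    have h3 : ((N + 2 : ℕ) : ℝ) = ((N + 1 : ℕ) : ℝ) + 1 := by push_cast; ring
    rw [h2, h3]
    linarith [hηp (N + 1 + 1) (by omega)]
  have hcubes : ∑ t ∈ range (N + 1), η (t + 1) ^ 3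
      ≤ γ ^ 3 * (1 / (1 + lam) + Real.log (((N + 2 : ℕ) : ℝ) - 1 + lam)) := by
    have h1 := mul_le_mul_of_nonneg_left (sum_inv_le_log hlam N) (by positivity : 0 ≤ γ ^ 3)
    have h2 : ∑ t ∈ range (N + 1), η (t + 1) ^ 3
        = γ ^ 3 * ∑ t ∈ range (N + 1), 1 / (((t + 1 : ℕ) : ℝ) + lam) := by
      rw [mul_sum]
      refine sum_congr rfl fun t _ => ?_
      rw [hη (t + 1) (by omega), div_pow, ← Real.rpow_natCast, ← Real.rpow_natCast,
        ← Real.rpow_mul (by positivity)]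
      norm_num [div_eq_mul_inv]
    have h3 : ((N + 2 : ℕ) : ℝ) - 1 + lam = (N : ℝ) + 1 + lam := by push_cast; ring
    rw [h2, h3]
    exact h1
  have hη1 : η 1 = γ / (1 + lam) ^ ((1 : ℝ) / 3) := by rw [hη 1 le_rfl, Nat.cast_one]
  have hη1sq : η 1 ^ 2 = γ ^ 2 / (1 + lam) ^ ((2 : ℝ) / 3) := by
    rw [hη1, div_pow, ← Real.rpow_natCast ((1 + lam) ^ _), ← Real.rpow_mul (by positivity)]
    norm_num
  have hlow : Fstar ≤ F (wt (N + 2)) := hFstar.1 ⟨_, rfl⟩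
  have hlow0 : Fstar ≤ F (wt 0) := hFstar.1 ⟨_, rfl⟩
  have hlog : 0 ≤ Real.log (((N + 2 : ℕ) : ℝ) - 1 + lam) := by
    refine Real.log_nonneg ?_
    push_cast
    linarith [(Nat.cast_nonneg N : (0 : ℝ) ≤ N)]
  have hΔ : 0 < (((N + 2 : ℕ) : ℝ) + lam) ^ ((2 : ℝ) / 3) - (1 + lam) ^ ((2 : ℝ) / 3) := by
    refine sub_pos.2 (Real.rpow_lt_rpow (by positivity) ?_ (by norm_num))
    push_cast
    linarith [(Nat.cast_nonneg N : (0 : ℝ) ≤ N)]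
  set Δ := (((N + 2 : ℕ) : ℝ) + lam) ^ ((2 : ℝ) / 3) - (1 + lam) ^ ((2 : ℝ) / 3)
  set ℓ := Real.log (((N + 2 : ℕ) : ℝ) - 1 + lam)
  set S := ∑ t ∈ Icc 1 (N + 2), η t with hSdef
  have hSpos : 0 < S := (mul_pos hγ hΔ).trans_le hS
  set D := 2 * R / γ * (F (wt 0) - Fstar)
            + (R / (γ * L) + R / ((1 : ℝ) + lam) ^ ((1 : ℝ) / 3))
              * ‖gradient F (wt 0)‖ ^ 2
            + 2 * R * L * γ * G ^ 2 / ((1 : ℝ) + lam) ^ ((2 : ℝ) / 3)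
            + 2 / (1 + lam) * L ^ 2 * G ^ 2 * γ ^ 2 with hD
  have hγD : γ * D = R * (2 * (F (wt 0) - Fstar) + 1 / L * ‖gradient F (wt 0)‖ ^ 2
      + η 1 * ‖gradient F (wt 0)‖ ^ 2 + 2 * L * G ^ 2 * η 1 ^ 2)
      + 2 * (L ^ 2 * G ^ 2 * γ ^ 3 * (1 / (1 + lam))) := by
    rw [hD, hη1sq, hη1]
    field_simp
    ring
  have hD0 : 0 ≤ D := by
    have := sub_nonneg.2 hlow0
    rw [hD]
    positivity
  have hmain : ∑ t ∈ Icc 1 (N + 2), η t * ‖gradient F (wt (t - 1))‖ ^ 2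
      ≤ γ * (D + L ^ 2 * G ^ 2 * γ ^ 2 * ℓ) + 4 * β ^ n * G ^ 2 * S := by
    have h1 := htel (N + 1) (by omega)
    rw [hIcc, sum_range_succ', zero_add, Nat.sub_self]
    simp only [Nat.add_sub_cancel]
    have h2 : S = ∑ t ∈ range (N + 1), η (t + 2) + η 1 := by
      rw [hSdef, hIcc, sum_range_succ']
    have h3 : 4 * β ^ n * G ^ 2 * ∑ t ∈ range (N + 1), η (t + 2) ≤ 4 * β ^ n * G ^ 2 * S := by
      refine mul_le_mul_of_nonneg_left ?_ (by positivity)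
      linarith [hηp 1 le_rfl]
    have h4 := mul_le_mul_of_nonneg_left hcubes (by positivity : 0 ≤ L ^ 2 * G ^ 2)
    have h5 : 0 ≤ 2 * (F (wt 0) - Fstar) + 1 / L * ‖gradient F (wt 0)‖ ^ 2
        + η 1 * ‖gradient F (wt 0)‖ ^ 2 + 2 * L * G ^ 2 * η 1 ^ 2 := by
      have := sub_nonneg.2 hlow0
      have := hηp 1 le_rfl
      positivity
    have h6 := mul_le_mul_of_nonneg_right hR h5
    have h7 : 0 ≤ L ^ 2 * G ^ 2 * γ ^ 3 * (1 / (1 + lam)) := by positivity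
    rw [mul_add, hγD]
    linarith
  have hfrac : γ * (D + L ^ 2 * G ^ 2 * γ ^ 2 * ℓ) / S ≤ (D + L ^ 2 * G ^ 2 * γ ^ 2 * ℓ) / Δ := by
    rw [div_le_div_iff₀ hSpos hΔ]
    have h1 := mul_le_mul_of_nonneg_left hS (by positivity : 0 ≤ D + L ^ 2 * G ^ 2 * γ ^ 2 * ℓ)
    linarith
  have hν' : 4 * β ^ n * G ^ 2 ≤ 4 * ν * G ^ 2 * R / ((N + 2 : ℕ) : ℝ) ^ ((2 : ℝ) / 3) := by
    have h1 : 4 * ν * G ^ 2 * R / ((N + 2 : ℕ) : ℝ) ^ ((2 : ℝ) / 3) = 4 * β ^ n * G ^ 2 * R := by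
      rw [hq]
      ring
    rw [h1]
    exact le_mul_of_one_le_right (by positivity) hR
  calc _ ≤ (γ * (D + L ^ 2 * G ^ 2 * γ ^ 2 * ℓ) + 4 * β ^ n * G ^ 2 * S) / S := by gcongr
    _ = γ * (D + L ^ 2 * G ^ 2 * γ ^ 2 * ℓ) / S + 4 * β ^ n * G ^ 2 := by field_simp
    _ ≤ _ := by rw [← add_div]; exact add_le_add hfrac hν'
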